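/- Let A be a coalgebra over a field k and let X ⊆ A be a finite-dimensional subspace. Then there exists a finite-dimensional subcoalgebra C of A with X ⊆ C. (The finiteness assertion of Proposition 3.3 of the paper, a form of the Fundamental Theorem of Coalgebras.) -/

import Mathlib

open TensorProduct

/-- The image in `A ⊗[k] A` of `U ⊗[k] V` under the tensor product of the inclusion maps. -/
noncomputable def tmulSub {k A : Type*} [Field k] [AddCommGroup A] [Module k A]
    (U : Submodule k A) (V : Submodule k A) : Submodule k (A ⊗[k] A) :=
  LinearMap.range (TensorProduct.map U.subtype V.subtype)

/-- slice on the right factor -/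
noncomputable def sliceL {k A : Type*} [Field k] [AddCommGroup A] [Module k A]
    (g : A →ₗ[k] k) : A ⊗[k] A →ₗ[k] A :=
  (TensorProduct.rid k A).toLinearMap ∘ₗ LinearMap.lTensor A g

/-- slice on the left factor -/
noncomputable def sliceR {k A : Type*} [Field k] [AddCommGroup A] [Module k A]
    (f : A →ₗ[k] k) : A ⊗[k] A →ₗ[k] A :=
  (TensorProduct.lid k A).toLinearMap ∘ₗ LinearMap.rTensor A f

section
variable {k A : Type*} [Field k] [AddCommGroup A] [Module k A]

lemma sliceL_tmul (g : A →ₗ[k] k) (a b : A) : sliceL g (a ⊗ₜ[k] b) = g b • a := by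
  simp [sliceL]

lemma sliceR_tmul (g : A →ₗ[k] k) (a b : A) : sliceR g (a ⊗ₜ[k] b) = g a • b := by
  simp [sliceR]

lemma sliceR_comm (g : A →ₗ[k] k) (t : A ⊗[k] A) :
    sliceL g (TensorProduct.comm k A A t) = sliceR g t := by
  induction t with
  | zero => simp
  | tmul a b => simp [sliceL_tmul, sliceR_tmul]
  | add x y hx hy => simp [hx, hy]

lemma sliceL_fin (t : A ⊗[k] A) : ∃ M : Submodule k A, M.FG ∧ ∀ g, sliceL g t ∈ M := by
  induction t with
  | zero => exact ⟨⊥, Submodule.fg_bot, by simp⟩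
  | tmul a b =>
    refine ⟨k ∙ a, Submodule.fg_span_singleton a, fun g => ?_⟩
    rw [sliceL_tmul]
    exact Submodule.smul_mem _ _ (Submodule.mem_span_singleton_self a)
  | add x y hx hy =>
    obtain ⟨M, hM, h1⟩ := hx
    obtain ⟨N, hN, h2⟩ := hy
    refine ⟨M ⊔ N, hM.sup hN, fun g => ?_⟩
    rw [map_add]
    exact Submodule.add_mem_sup (h1 g) (h2 g)

lemma sliceR_fin (t : A ⊗[k] A) : ∃ M : Submodule k A, M.FG ∧ ∀ g, sliceR g t ∈ M := by
  obtain ⟨M, hM, h⟩ := sliceL_fin (TensorProduct.comm k A A t)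
  exact ⟨M, hM, fun g => sliceR_comm g t ▸ h g⟩

lemma sliceL_sep (t : A ⊗[k] A) (h : ∀ g, sliceL g t = 0) : t = 0 := by
  let b := Module.Basis.ofVectorSpace k A
  apply (b.tensorProduct b).repr.injective
  ext ⟨i, j⟩
  have key : ∀ t : A ⊗[k] A, (b.tensorProduct b).repr t (i, j) = b.coord i (sliceL (b.coord j) t) := by
    intro t
    induction t with
    | zero => simp
    | tmul x y => simp [sliceL_tmul, mul_comm]
    | add x y hx hy => simp only [map_add, Finsupp.add_apply, hx, hy]
  rw [key, h]; simp

lemma sliceR_sep (t : A ⊗[k] A) (h : ∀ g, sliceR g t = 0) : t = 0 := by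
  have := sliceL_sep (TensorProduct.comm k A A t) (fun g => by rw [sliceR_comm, h])
  simpa using this

lemma mem_of_slices (C : Submodule k A) (t : A ⊗[k] A) (hL : ∀ g, sliceL g t ∈ C)
    (hR : ∀ g, sliceR g t ∈ C) : t ∈ tmulSub C C := by
  obtain ⟨p, hp⟩ := C.subtype.exists_leftInverse_of_injective (by simp)
  have hpc : ∀ c ∈ C, (p c : A) = c := fun c hc => by
    have := LinearMap.congr_fun hp ⟨c, hc⟩
    simpa using congrArg Subtype.val this
  let q : A →ₗ[k] A := C.subtype ∘ₗ p
  have h1 : TensorProduct.map q LinearMap.id t = t := by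
    rw [← sub_eq_zero]
    apply sliceL_sep
    intro g
    have key : ∀ t : A ⊗[k] A, sliceL g (TensorProduct.map q LinearMap.id t) = q (sliceL g t) := by
      intro t
      induction t with
      | zero => simp
      | tmul x y => simp [sliceL_tmul]
      | add x y hx hy => simp only [map_add, hx, hy]
    rw [map_sub, key, sub_eq_zero]
    exact hpc _ (hL g)
  have h2 : TensorProduct.map LinearMap.id q t = t := by
    rw [← sub_eq_zero]
    apply sliceR_sep
    intro g
    have key : ∀ t : A ⊗[k] A, sliceR g (TensorProduct.map LinearMap.id q t) = q (sliceR g t) := by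
      intro t
      induction t with
      | zero => simp
      | tmul x y => simp [sliceR_tmul]
      | add x y hx hy => simp only [map_add, hx, hy]
    rw [map_sub, key, sub_eq_zero]
    exact hpc _ (hR g)
  refine ⟨TensorProduct.map p p t, ?_⟩
  have h3 : TensorProduct.map C.subtype C.subtype (TensorProduct.map p p t)
      = TensorProduct.map q LinearMap.id (TensorProduct.map LinearMap.id q t) := by
    rw [← LinearMap.comp_apply, ← LinearMap.comp_apply, ← TensorProduct.map_comp,
      ← TensorProduct.map_comp]
    rfl
  rw [h3, h2, h1]

lemma orbit_fg {ι : Type*} (L : ι → A →ₗ[k] A)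
    (fin : ∀ a, ∃ M : Submodule k A, M.FG ∧ ∀ i, L i a ∈ M) (X : Submodule k A) (hX : X.FG) :
    (⨆ i, X.map (L i)).FG := by
  have : ∃ M : Submodule k A, M.FG ∧ ∀ i, X.map (L i) ≤ M := by
    induction X, hX using Submodule.fg_induction with
    | singleton x =>
      obtain ⟨M, hM, h⟩ := fin x
      refine ⟨M, hM, fun i => ?_⟩
      rw [Submodule.map_span_le]
      rintro y rfl
      exact h i
    | sup X Y _ _ hX hY =>
      obtain ⟨M, hM, h1⟩ := hX
      obtain ⟨N, hN, h2⟩ := hY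
      refine ⟨M ⊔ N, hM.sup hN, fun i => ?_⟩
      rw [Submodule.map_sup]
      exact sup_le_sup (h1 i) (h2 i)
  obtain ⟨M, hM, h⟩ := this
  have : FiniteDimensional k M := Module.Finite.iff_fg.2 hM
  have : FiniteDimensional k (⨆ i, X.map (L i) : Submodule k A) :=
    Submodule.finiteDimensional_of_le (iSup_le h)
  exact Module.Finite.iff_fg.1 this

end

section
variable {k A : Type*} [Field k] [AddCommGroup A] [Module k A] [Coalgebra k A]

/-- left-stable action -/
noncomputable def actL (g : A →ₗ[k] k) : A →ₗ[k] A := sliceL g ∘ₗ Coalgebra.comul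

/-- right-stable action -/
noncomputable def actR (g : A →ₗ[k] k) : A →ₗ[k] A := sliceR g ∘ₗ Coalgebra.comul

/-- convolution of functionals -/
noncomputable def cv (f g : A →ₗ[k] k) : A →ₗ[k] k :=
  (TensorProduct.lid k k).toLinearMap ∘ₗ TensorProduct.map f g ∘ₗ Coalgebra.comul

lemma actL_counit : actL (Coalgebra.counit (R := k) (A := A)) = LinearMap.id := by
  ext a; simp [actL, sliceL]

lemma actR_counit : actR (Coalgebra.counit (R := k) (A := A)) = LinearMap.id := by
  ext a; simp [actR, sliceR]

/-- triple contraction helper -/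
lemma actL_actL (h g : A →ₗ[k] k) (a : A) : actL h (actL g a) = actL (cv h g) a := by
  have e1 : ∀ t : A ⊗[k] A, actL h (sliceL g t) =
      sliceL h (TensorProduct.rid k _ (LinearMap.lTensor _ g
        (LinearMap.rTensor A Coalgebra.comul t))) := by
    intro t
    induction t with
    | zero => simp
    | tmul x y => simp [sliceL_tmul, actL]
    | add x y hx hy => simp only [map_add, hx, hy]
  have e2 : ∀ t : A ⊗[k] (A ⊗[k] A), sliceL h (TensorProduct.rid k _ (LinearMap.lTensor _ g
        ((TensorProduct.assoc k A A A).symm t))) = TensorProduct.rid k A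
        (LinearMap.lTensor A ((TensorProduct.lid k k).toLinearMap ∘ₗ TensorProduct.map h g) t) := by
    intro t
    induction t with
    | zero => simp
    | tmul x s =>
      induction s with
      | zero => simp
      | tmul y z => simp [sliceL_tmul, smul_smul, mul_comm]
      | add x y hx hy => simp only [map_add, TensorProduct.tmul_add, hx, hy]
    | add x y hx hy => simp only [map_add, hx, hy]
  change actL h (sliceL g (Coalgebra.comul a)) = _
  rw [e1, ← Coalgebra.coassoc_symm_apply, e2, ← LinearMap.lTensor_comp_apply]
  rfl

lemma actR_actR (h g : A →ₗ[k] k) (a : A) : actR h (actR g a) = actR (cv g h) a := by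
  have e1 : ∀ t : A ⊗[k] A, actR h (sliceR g t) =
      sliceR h (TensorProduct.lid k _ (LinearMap.rTensor _ g
        (LinearMap.lTensor A Coalgebra.comul t))) := by
    intro t
    induction t with
    | zero => simp
    | tmul x y => simp [sliceR_tmul, actR]
    | add x y hx hy => simp only [map_add, hx, hy]
  have e2 : ∀ t : (A ⊗[k] A) ⊗[k] A, sliceR h (TensorProduct.lid k _ (LinearMap.rTensor _ g
        (TensorProduct.assoc k A A A t))) = TensorProduct.lid k A
        (LinearMap.rTensor A ((TensorProduct.lid k k).toLinearMap ∘ₗ TensorProduct.map g h) t) := by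
    intro t
    induction t with
    | zero => simp
    | tmul s z =>
      induction s with
      | zero => simp
      | tmul x y => simp [sliceR_tmul, smul_smul, mul_comm]
      | add x y hx hy => simp only [map_add, TensorProduct.add_tmul, hx, hy]
    | add x y hx hy => simp only [map_add, hx, hy]
  change actR h (sliceR g (Coalgebra.comul a)) = _
  rw [e1, ← Coalgebra.coassoc_apply, e2, ← LinearMap.rTensor_comp_apply]
  rfl

lemma actL_actR (h g : A →ₗ[k] k) (a : A) : actL h (actR g a) = actR g (actL h a) := by
  have e1 : ∀ t : A ⊗[k] A, actL h (sliceR g t) =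
      sliceL h (TensorProduct.lid k _ (LinearMap.rTensor _ g
        (LinearMap.lTensor A Coalgebra.comul t))) := by
    intro t
    induction t with
    | zero => simp
    | tmul x y => simp [sliceR_tmul, actL]
    | add x y hx hy => simp only [map_add, hx, hy]
  have e3 : ∀ t : A ⊗[k] A, actR g (sliceL h t) =
      sliceR g (TensorProduct.rid k _ (LinearMap.lTensor _ h
        (LinearMap.rTensor A Coalgebra.comul t))) := by
    intro t
    induction t with
    | zero => simp
    | tmul x y => simp [sliceL_tmul, actR]
    | add x y hx hy => simp only [map_add, hx, hy]
  have e2 : ∀ t : (A ⊗[k] A) ⊗[k] A, sliceL h (TensorProduct.lid k _ (LinearMap.rTensor _ g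
        (TensorProduct.assoc k A A A t))) =
      sliceR g (TensorProduct.rid k _ (LinearMap.lTensor _ h t)) := by
    intro t
    induction t with
    | zero => simp
    | tmul s z =>
      induction s with
      | zero => simp
      | tmul x y => simp [sliceR_tmul, sliceL_tmul, smul_smul, mul_comm]
      | add x y hx hy => simp only [map_add, TensorProduct.add_tmul, hx, hy]
    | add x y hx hy => simp only [map_add, hx, hy]
  change actL h (sliceR g (Coalgebra.comul a)) = actR g (sliceL h (Coalgebra.comul a))
  rw [e1, ← Coalgebra.coassoc_apply, e2, e3]

end

/-- The finiteness assertion of Proposition 3.3 (Fundamental Theorem of Coalgebras):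
every finite-dimensional subspace `X` of a coalgebra `A` is contained in a
finite-dimensional subcoalgebra `C` of `A`. -/
theorem stmt_8 {k A : Type*} [Field k] [AddCommGroup A] [Module k A] [Coalgebra k A]
    (X : Submodule k A) (hX : FiniteDimensional k X) :
    ∃ C : Submodule k A, X ≤ C ∧ FiniteDimensional k C ∧
      ∀ c ∈ C, Coalgebra.comul (R := k) c ∈ tmulSub C C := by
  let Y : Submodule k A := ⨆ g : A →ₗ[k] k, X.map (actL g)
  let Z : Submodule k A := ⨆ g : A →ₗ[k] k, Y.map (actR g)
  have hY : Y.FG := orbit_fg _ (fun a => sliceL_fin _) X (Module.Finite.iff_fg.1 hX)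
  have hZ : Z.FG := orbit_fg _ (fun a => sliceR_fin _) Y hY
  have hXY : X ≤ Y := by
    refine le_trans (le_of_eq ?_) (le_iSup _ (Coalgebra.counit (R := k) (A := A)))
    rw [actL_counit, Submodule.map_id]
  have hYZ : Y ≤ Z := by
    refine le_trans (le_of_eq ?_) (le_iSup _ (Coalgebra.counit (R := k) (A := A)))
    rw [actR_counit, Submodule.map_id]
  have hYL : ∀ h : A →ₗ[k] k, Y ≤ Y.comap (actL h) := by
    intro h
    refine iSup_le fun g => ?_
    rintro _ ⟨x, hx, rfl⟩
    rw [Submodule.mem_comap, actL_actL]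
    exact Submodule.mem_iSup_of_mem (cv h g) (Submodule.mem_map_of_mem hx)
  have hZR : ∀ h : A →ₗ[k] k, Z ≤ Z.comap (actR h) := by
    intro h
    refine iSup_le fun g => ?_
    rintro _ ⟨x, hx, rfl⟩
    rw [Submodule.mem_comap, actR_actR]
    exact Submodule.mem_iSup_of_mem (cv g h) (Submodule.mem_map_of_mem hx)
  have hZL : ∀ h : A →ₗ[k] k, Z ≤ Z.comap (actL h) := by
    intro h
    refine iSup_le fun g => ?_
    rintro _ ⟨x, hx, rfl⟩
    rw [Submodule.mem_comap, actL_actR]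
    exact Submodule.mem_iSup_of_mem g (Submodule.mem_map_of_mem (hYL h hx))
  exact ⟨Z, hXY.trans hYZ, Module.Finite.iff_fg.2 hZ, fun c hc =>
    mem_of_slices Z _ (fun g => hZL g hc) (fun g => hZR g hc)⟩
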